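/- Let p be a prime, let ℤ_p be the ring of p-adic integers with its Haar probability measure, let a ∈ ℤ_p with a ≠ 0, let w : ℤ_p → (0,∞) be a bounded continuous function, and let p' ∈ [1,∞). If the weighted translation operator T_{a,w} on L^{p'}(ℤ_p), defined by (T_{a,w} f)(x) = w(x)·f(x − a), is hypercyclic, then ∫_{ℤ_p} ln(w(x)) dx = 0. -/

import Mathlib

open MeasureTheory
open scoped ENNReal

/-- A continuous function on `ℤ_[p]` with positive integral has Birkhoff sums along `x ↦ x - a`
that are uniformly bounded below on some coset of `a ℤ_[p]`. -/
theorem PadicInt.exists_forall_neg_le_sum_sub_mul {p : ℕ} [Fact p.Prime]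
    [MeasurableSpace ℤ_[p]] [BorelSpace ℤ_[p]]
    (μ : Measure ℤ_[p]) [μ.IsAddHaarMeasure] [IsProbabilityMeasure μ]
    (a : ℤ_[p]) (φ : ℤ_[p] → ℝ) (hφ : Continuous φ) (hpos : 0 < ∫ x, φ x ∂μ) :
    ∃ (x₀ : ℤ_[p]) (B : ℝ), ∀ (n : ℕ) (z : ℤ_[p]),
      -B ≤ ∑ j ∈ Finset.range n, φ (x₀ + a * z - j * a) := by
  set I := ∫ x, φ x ∂μ with hI
  obtain ⟨η, hη, hφη⟩ := Metric.uniformContinuous_iff.1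
    (CompactSpace.uniformContinuous_of_continuous hφ) (I / 2) (by positivity)
  obtain ⟨m, hm⟩ := PadicInt.exists_pow_neg_lt p hη
  set N := p ^ m with hN
  have hNpos : 0 < N := pow_pos (Fact.out : p.Prime).pos m
  have close : ∀ x c : ℤ_[p], ‖c‖ ≤ (p : ℝ) ^ (-(m : ℤ)) → |φ (x + a * c) - φ x| ≤ I / 2 := by
    intro x c hc
    have hd : dist (x + a * c) x < η := by
      rw [dist_eq_norm, add_sub_cancel_left, norm_mul]
      calc ‖a‖ * ‖c‖ ≤ 1 * ‖c‖ := by gcongr; exact a.norm_le_one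
        _ < η := by rw [one_mul]; exact hc.trans_lt hm
    exact (hφη hd).le
  have hint : ∀ f : ℤ_[p] → ℝ, Continuous f → Integrable f μ := fun f hf =>
    hf.integrable_of_hasCompactSupport (HasCompactSupport.of_compactSpace f)
  have hsum : ∫ x, ∑ j ∈ Finset.range N, φ (x - j * a) ∂μ = N * I := by
    rw [integral_finsetSum _ fun j _ => hint _ (by fun_prop)]
    simp [integral_sub_right_eq_self φ, hI]
  obtain ⟨x₀, hx₀⟩ := exists_integral_le (μ := μ)
    (f := fun x => ∑ j ∈ Finset.range N, φ (x - j * a)) (hint _ (by fun_prop))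
  rw [hsum] at hx₀
  have block : ∀ z : ℤ_[p], 0 ≤ ∑ j ∈ Finset.range N, φ (x₀ + a * z - j * a) := by
    intro z
    set k := (-z).appr m with hk
    have hkN : k ≤ N := (PadicInt.appr_lt (-z) m).le
    have hkz : ‖-z - k‖ ≤ (p : ℝ) ^ (-(m : ℤ)) :=
      (PadicInt.norm_le_pow_iff_mem_span_pow _ _).2 (PadicInt.appr_spec m (-z))
    have h1 : ∑ j ∈ Finset.range N, φ (x₀ - (k + j : ℕ) * a) - N * (I / 2) ≤
        ∑ j ∈ Finset.range N, φ (x₀ + a * z - j * a) := by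
      have : (N : ℝ) * (I / 2) = ∑ j ∈ Finset.range N, I / 2 := by simp
      rw [this, ← Finset.sum_sub_distrib]
      refine Finset.sum_le_sum fun j _ => ?_
      have h := (abs_le.1 (close (x₀ + a * z - j * a) (-z - k) hkz)).2
      have e : x₀ + a * z - j * a + a * (-z - k) = x₀ - (k + j : ℕ) * a := by
        push_cast; ring
      rw [e] at h
      linarith
    have h2 : ∑ j ∈ Finset.range N, φ (x₀ - j * a) - N * (I / 2) ≤
        ∑ j ∈ Finset.range N, φ (x₀ - (k + j : ℕ) * a) := by
      have e1 := Finset.sum_range_add (fun j : ℕ => φ (x₀ - j * a)) k N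
      have e2 := Finset.sum_range_add (fun j : ℕ => φ (x₀ - j * a)) N k
      rw [add_comm N k] at e2
      have h3 : ∑ j ∈ Finset.range k, φ (x₀ - j * a) - k * (I / 2) ≤
          ∑ j ∈ Finset.range k, φ (x₀ - (N + j : ℕ) * a) := by
        have : (k : ℝ) * (I / 2) = ∑ j ∈ Finset.range k, I / 2 := by simp
        rw [this, ← Finset.sum_sub_distrib]
        refine Finset.sum_le_sum fun j _ => ?_
        have h := (abs_le.1 (close (x₀ - j * a) (-(N : ℤ_[p])) (by simp [hN]))).1
        have e : x₀ - j * a + a * (-(N : ℤ_[p])) = x₀ - (N + j : ℕ) * a := by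
          push_cast; ring
        rw [e] at h
        linarith
      have h4 : (k : ℝ) * (I / 2) ≤ N * (I / 2) := by gcongr
      linarith
    linarith
  obtain ⟨M, hM⟩ : ∃ M, ∀ x, ‖φ x‖ ≤ M := by
    obtain ⟨M, hM⟩ := isCompact_univ.exists_bound_of_continuousOn hφ.continuousOn
    exact ⟨M, fun x => hM x trivial⟩
  have hM0 : 0 ≤ M := (norm_nonneg _).trans (hM 0)
  refine ⟨x₀, N * M, fun n => ?_⟩
  induction n using Nat.strong_induction_on with
  | _ n ih =>
    intro z
    rcases lt_or_ge n N with h | h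
    · have h1 : ∑ j ∈ Finset.range n, (-M) ≤
          ∑ j ∈ Finset.range n, φ (x₀ + a * z - j * a) :=
        Finset.sum_le_sum fun j _ => (abs_le.1 (hM _)).1
      have h2 : (n : ℝ) * M ≤ N * M := by gcongr
      simp only [Finset.sum_const, Finset.card_range, nsmul_eq_mul] at h1
      linarith
    · obtain ⟨r, rfl⟩ := Nat.exists_eq_add_of_le h
      rw [Finset.sum_range_add]
      have h1 := ih r (by omega) (z - N)
      have e : ∀ j : ℕ, x₀ + a * (z - N) - j * a = x₀ + a * z - (N + j : ℕ) * a := by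
        intro j; push_cast; ring
      simp only [e] at h1
      linarith [block z]

/-- A sequence with dense range in `L^q(μ)` is not bounded in `L^q` over a set of positive
measure. -/
theorem MeasureTheory.Lp.not_dense_range_of_eLpNorm_restrict_le {α : Type*} [MeasurableSpace α]
    {μ : Measure α} [IsFiniteMeasure μ] {q : ℝ≥0∞} [Fact (1 ≤ q)] {K : Set α} (hK : μ K ≠ 0)
    (u : ℕ → Lp ℝ q μ) (D : ℝ≥0∞) (hD : D ≠ ∞)
    (hu : ∀ n, eLpNorm (u n) q (μ.restrict K) ≤ D) : ¬ Dense (Set.range u) := by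
  intro hd
  have hq0 : q ≠ 0 := (zero_lt_one.trans_le (Fact.out : 1 ≤ q)).ne'
  set t : ℝ≥0∞ := (μ.restrict K Set.univ) ^ (1 / q.toReal) with ht
  have ht0 : t ≠ 0 := by
    rw [ht, Measure.restrict_apply_univ]
    simp [ENNReal.rpow_eq_zero_iff, hK, measure_ne_top]
  have key : ∀ c : ℝ, ‖c‖ₑ * t ≤ 1 + D := by
    intro c
    have hc : MemLp (fun _ : α => c) q μ := memLp_const c
    obtain ⟨_, hn, n, rfl⟩ := Metric.dense_iff.1 hd hc.toLp 1 one_pos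
    have h1 : eLpNorm (⇑hc.toLp - ⇑(u n)) q μ ≤ 1 := by
      rw [Metric.mem_ball, dist_comm, ← edist_lt_ofReal, Lp.edist_def, ENNReal.ofReal_one] at hn
      exact hn.le
    have e : (fun _ : α => c) =ᵐ[μ.restrict K] (⇑hc.toLp - ⇑(u n)) + ⇑(u n) := by
      filter_upwards [ae_restrict_of_ae hc.coeFn_toLp] with x hx
      rw [sub_add_cancel, hx]
    calc ‖c‖ₑ * t = eLpNorm (fun _ : α => c) q (μ.restrict K) := by
          rw [eLpNorm_const c hq0]
          simpa [Measure.restrict_eq_zero] using hK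
      _ = eLpNorm ((⇑hc.toLp - ⇑(u n)) + ⇑(u n)) q (μ.restrict K) := eLpNorm_congr_ae e
      _ ≤ eLpNorm (⇑hc.toLp - ⇑(u n)) q (μ.restrict K) + eLpNorm (u n) q (μ.restrict K) :=
          eLpNorm_add_le (((Lp.aestronglyMeasurable _).sub (Lp.aestronglyMeasurable _)).restrict)
            (Lp.aestronglyMeasurable _).restrict Fact.out
      _ ≤ 1 + D := add_le_add ((eLpNorm_restrict_le _ _ _ _).trans h1) (hu n)
  have htop : (1 + D) / t ≠ ∞ := ENNReal.div_ne_top (by simp [hD]) ht0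
  have h1 := key ((1 + D) / t + 1).toReal
  have htt : t ≠ ∞ := ENNReal.rpow_ne_top_of_nonneg (by positivity) (measure_ne_top _ _)
  rw [Real.enorm_eq_ofReal ENNReal.toReal_nonneg, ENNReal.ofReal_toReal (by simp [htop]),
    add_mul, ENNReal.div_mul_cancel ht0 htt, one_mul] at h1
  have h2 : 1 + D < 1 + D + t := ENNReal.lt_add_right (by simp [hD]) ht0
  exact absurd h1 h2.not_ge

/-- The iterates of a weighted translation, with the weight cocycle written as the exponential of
a Birkhoff sum. -/
theorem weightedTranslation_pow_ae_eq {R : Type*} [CommRing R] [MeasurableSpace R]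
    [MeasurableAdd R] {μ : Measure R} [μ.IsAddRightInvariant] {q : ℝ≥0∞} [Fact (1 ≤ q)]
    (a : R) (w : R → ℝ) (hw_pos : ∀ x, 0 < w x) (T : Lp ℝ q μ →L[ℝ] Lp ℝ q μ)
    (hT : ∀ f : Lp ℝ q μ, (T f : R → ℝ) =ᵐ[μ] fun x => w x * f (x - a))
    (f : Lp ℝ q μ) (n : ℕ) :
    ((T ^ n) f : R → ℝ) =ᵐ[μ] fun x =>
      Real.exp (∑ j ∈ Finset.range n, Real.log (w (x - j * a))) * f (x - n * a) := by
  induction n with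
  | zero => simp
  | succ n ih =>
    rw [pow_succ', mul_apply_eq_comp]
    filter_upwards [hT ((T ^ n) f),
      (measurePreserving_sub_right μ a).quasiMeasurePreserving.ae ih] with x h1 h2
    have e : ∀ j : ℕ, x - a - j * a = x - (j + 1 : ℕ) * a := by
      intro j; push_cast; ring
    simp only [e] at h2
    rw [h1, h2, Finset.sum_range_succ', Real.exp_add]
    simp only [Nat.cast_zero, zero_mul, sub_zero]
    rw [Real.exp_log (hw_pos x)]
    ring

/-- If the weighted translation `T_{a,w}` (with `a ≠ 0`) is hypercyclic on
`L^{p'}(ℤ_p)`, then `∫_{ℤ_p} ln w = 0`. -/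
theorem padicInt_hypercyclic_integral_log_eq_zero
    {p : ℕ} [Fact p.Prime]
    [MeasurableSpace ℤ_[p]] [BorelSpace ℤ_[p]]
    (μ : Measure ℤ_[p]) [μ.IsAddHaarMeasure] [IsProbabilityMeasure μ]
    (a : ℤ_[p]) (ha : a ≠ 0)
    (w : ℤ_[p] → ℝ) (hw_cont : Continuous w) (hw_pos : ∀ x, 0 < w x)
    (hw_bdd : ∃ C : ℝ, ∀ x, w x ≤ C)
    (p' : ℝ≥0∞) [Fact (1 ≤ p')] (hp'_top : p' ≠ ∞)
    (T : Lp ℝ p' μ →L[ℝ] Lp ℝ p' μ)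
    (hT : ∀ f : Lp ℝ p' μ, (T f : ℤ_[p] → ℝ) =ᵐ[μ] fun x => w x * f (x - a))
    (hhyp : ∃ f : Lp ℝ p' μ, Dense (Set.range fun n : ℕ => ((T ^ n) f))) :
    ∫ x, Real.log (w x) ∂μ = 0 := by
  obtain ⟨f, hf⟩ := hhyp
  have hlog : Continuous fun x => Real.log (w x) := hw_cont.log fun x => (hw_pos x).ne'
  have hpow := weightedTranslation_pow_ae_eq a w hw_pos T hT f
  set K : ℤ_[p] → Set ℤ_[p] := fun x₀ => Metric.closedBall x₀ ‖a‖ with hKdef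
  have hKm : ∀ x₀, MeasurableSet (K x₀) := fun x₀ => Metric.isClosed_closedBall.measurableSet
  have hK0 : ∀ x₀, μ (K x₀) ≠ 0 := fun x₀ =>
    (Metric.measure_closedBall_pos μ x₀ (norm_pos_iff.2 ha)).ne'
  have hKz : ∀ x₀, ∀ x ∈ K x₀, ∃ z, x = x₀ + a * z := by
    intro x₀ x hx
    rw [hKdef, Metric.mem_closedBall, dist_eq_norm] at hx
    have ha' : (a : ℚ_[p]) ≠ 0 := by simpa using ha
    have hz : ‖((x - x₀ : ℤ_[p]) : ℚ_[p]) / a‖ ≤ 1 := by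
      rw [norm_div, div_le_one (norm_pos_iff.2 ha')]
      exact hx
    obtain ⟨z, hz'⟩ : ∃ z : ℤ_[p], (z : ℚ_[p]) = ((x - x₀ : ℤ_[p]) : ℚ_[p]) / a := ⟨⟨_, hz⟩, rfl⟩
    refine ⟨z, PadicInt.ext ?_⟩
    rw [PadicInt.coe_add, PadicInt.coe_mul, hz', mul_div_cancel₀ _ ha', PadicInt.coe_sub]
    ring
  have hKinv : ∀ x₀ (n : ℕ), (fun x => x - n * a) ⁻¹' K x₀ = K x₀ := by
    intro x₀ n
    have hn : ‖(n : ℤ_[p]) * a‖ ≤ ‖a‖ := by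
      rw [norm_mul]
      exact mul_le_of_le_one_left (norm_nonneg _) (PadicInt.norm_le_one _)
    ext x
    simp only [hKdef, Set.mem_preimage, Metric.mem_closedBall, dist_eq_norm]
    constructor <;> intro h
    · rw [show x - x₀ = (x - n * a - x₀) + n * a by ring]
      exact (PadicInt.nonarchimedean _ _).trans (max_le h hn)
    · rw [show x - n * a - x₀ = (x - x₀) + -(n * a) by ring]
      exact (PadicInt.nonarchimedean _ _).trans (max_le h (by rwa [norm_neg]))
  have hmp : ∀ x₀ (n : ℕ), MeasurePreserving (fun x => x - n * a) (μ.restrict (K x₀))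
      (μ.restrict (K x₀)) := by
    intro x₀ n
    have h := (measurePreserving_sub_right μ ((n : ℤ_[p]) * a)).restrict_preimage (hKm x₀)
    rwa [hKinv] at h
  have htrans : ∀ x₀ (n : ℕ), eLpNorm (fun x => f (x - n * a)) p' (μ.restrict (K x₀)) =
      eLpNorm f p' (μ.restrict (K x₀)) := fun x₀ n =>
    eLpNorm_comp_measurePreserving (Lp.aestronglyMeasurable f).restrict (hmp x₀ n)
  have hfin : ∀ x₀, eLpNorm f p' (μ.restrict (K x₀)) ≠ ∞ := fun x₀ =>
    ((eLpNorm_restrict_le _ _ _ _).trans_lt (Lp.eLpNorm_lt_top f)).ne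
  rcases lt_trichotomy (∫ x, Real.log (w x) ∂μ) 0 with h | h | h
  · exfalso
    obtain ⟨x₀, B, hB⟩ := PadicInt.exists_forall_neg_le_sum_sub_mul μ a
      (fun x => -Real.log (w x)) hlog.neg (by rw [integral_neg]; linarith)
    refine Lp.not_dense_range_of_eLpNorm_restrict_le (hK0 x₀) (fun n => (T ^ n) f)
      (ENNReal.ofReal (Real.exp B) * eLpNorm f p' (μ.restrict (K x₀)))
      (ENNReal.mul_ne_top ENNReal.ofReal_ne_top (hfin x₀)) (fun n => ?_) hf
    rw [← htrans x₀ n]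
    refine eLpNorm_le_mul_eLpNorm_of_ae_le_mul ?_ _
    filter_upwards [ae_restrict_of_ae (hpow n), ae_restrict_mem (hKm x₀)] with x hx hxK
    obtain ⟨z, rfl⟩ := hKz x₀ x hxK
    have h1 := hB n z
    rw [Finset.sum_neg_distrib] at h1
    rw [hx, norm_mul, Real.norm_of_nonneg (Real.exp_pos _).le]
    gcongr
    linarith
  · exact h
  · exfalso
    obtain ⟨x₀, B, hB⟩ := PadicInt.exists_forall_neg_le_sum_sub_mul μ a _ hlog h
    have hlow : ∀ n : ℕ, eLpNorm f p' (μ.restrict (K x₀)) ≤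
        ENNReal.ofReal (Real.exp B) * eLpNorm ((T ^ n) f) p' (μ.restrict (K x₀)) := by
      intro n
      rw [← htrans x₀ n]
      refine eLpNorm_le_mul_eLpNorm_of_ae_le_mul ?_ _
      filter_upwards [ae_restrict_of_ae (hpow n), ae_restrict_mem (hKm x₀)] with x hx hxK
      obtain ⟨z, rfl⟩ := hKz x₀ x hxK
      rw [hx, norm_mul, Real.norm_of_nonneg (Real.exp_pos _).le, ← mul_assoc, ← Real.exp_add]
      refine le_mul_of_one_le_left (norm_nonneg _) (Real.one_le_exp ?_)
      linarith [hB n z]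
    have hzero : eLpNorm f p' (μ.restrict (K x₀)) = 0 := by
      by_contra hne
      obtain ⟨_, ⟨n, rfl⟩, hn⟩ := EMetric.mem_closure_iff.1 (hf 0) _
        (ENNReal.div_pos hne (ENNReal.ofReal_ne_top (r := Real.exp B)))
      rw [edist_comm, edist_zero_right, Lp.enorm_def] at hn
      refine (hlow n).not_gt ((mul_le_mul_right (eLpNorm_restrict_le _ _ _ _) _).trans_lt ?_)
      exact ENNReal.mul_lt_of_lt_div' hn
    have hf0 : ∀ n : ℕ, eLpNorm ((T ^ n) f) p' (μ.restrict (K x₀)) = 0 := by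
      intro n
      have hp0 : p' ≠ 0 := (zero_lt_one.trans_le (Fact.out : 1 ≤ p')).ne'
      rw [eLpNorm_eq_zero_iff (Lp.aestronglyMeasurable _).restrict hp0] at hzero ⊢
      filter_upwards [ae_restrict_of_ae (hpow n),
        (hmp x₀ n).quasiMeasurePreserving.ae hzero] with x hx h0
      rw [hx, h0]
      simp
    exact Lp.not_dense_range_of_eLpNorm_restrict_le (hK0 x₀) (fun n => (T ^ n) f) 0
      ENNReal.zero_ne_top (fun n => (hf0 n).le) hf
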